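/- For every α with 0 < α < 1/3 there exists a constant C_α > 0 such that for every integer n ≥ 1 and every (a,b) ∈ {−1,1}²: | Σ_{n₁=0}^{2n} Σ_{n₂=0}^{2n} [ f( π(2n₁+1)/(2n+1) − π(a+1)/(2(2n+1)), π(2n₂+1)/(2n+1) − π(b+1)/(2(2n+1)) ) − f( π(2n₁+1)/(2n+1), π(2n₂+1)/(2n+1) ) ] | ≤ C_α · n^{3α−1}, where f(x,y) := −√(1 + (1/2)·cos x + (1/2)·cos y). -/

import Mathlib

theorem abs_third_difference_le {f f₁ f₂ f₃ : ℝ → ℝ} (h₁ : ∀ x, HasDerivAt f (f₁ x) x)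
    (h₂ : ∀ x, HasDerivAt f₁ (f₂ x) x) (h₃ : ∀ x, HasDerivAt f₂ (f₃ x) x) {x h M : ℝ}
    (hh : 0 ≤ h) (hM : ∀ t ∈ Set.Icc x (x + 3 * h), |f₃ t| ≤ M) :
    |f (x + 3 * h) - 3 * f (x + 2 * h) + 3 * f (x + h) - f x| ≤ M * h ^ 3 := by
  have mean_value : ∀ {g g' : ℝ → ℝ} {y K : ℝ}, (∀ t, HasDerivAt g (g' t) t) →
      (∀ t ∈ Set.Icc y (y + h), |g' t| ≤ K) → |g (y + h) - g y| ≤ K * h := by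
    intro g g' y K hg hK
    have := (convex_Icc y (y + h)).norm_image_sub_le_of_norm_hasDerivWithin_le
      (fun t _ => (hg t).hasDerivWithinAt) (fun t ht => by simpa using hK t ht)
      (Set.left_mem_Icc.2 (by linarith)) (Set.right_mem_Icc.2 (by linarith))
    simpa [abs_of_nonneg hh] using this
  have shift : ∀ {g g' : ℝ → ℝ}, (∀ t, HasDerivAt g (g' t) t) → ∀ c t,
      HasDerivAt (fun s => g (s + c)) (g' (t + c)) t :=
    fun hg c t => (hg (t + c)).comp_add_const t c
  have second : ∀ t ∈ Set.Icc x (x + 2 * h), |f₂ (t + h) - f₂ t| ≤ M * h := by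
    intro t ht
    refine mean_value h₃ fun s hs => hM s ⟨?_, ?_⟩ <;> linarith [ht.1, ht.2, hs.1, hs.2]
  have first : ∀ t ∈ Set.Icc x (x + h), |f₁ (t + h + h) - f₁ (t + h) - (f₁ (t + h) - f₁ t)|
      ≤ M * h * h := by
    intro t ht
    refine mean_value (g := fun s => f₁ (s + h) - f₁ s)
      (fun s => (shift h₂ h s).sub (h₂ s)) fun s hs => second s ⟨?_, ?_⟩ <;>
      linarith [ht.1, ht.2, hs.1, hs.2]
  have key := mean_value (g := fun s => f (s + h + h) - f (s + h) - (f (s + h) - f s)) (y := x)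
    (fun s => ((shift (shift h₁ h) h s).sub (shift h₁ h s)).sub ((shift h₁ h s).sub (h₁ s))) first
  convert key using 1
  · rw [show x + 3 * h = x + h + h + h by ring, show x + 2 * h = x + h + h by ring]
    congr 1
    ring
  · ring

theorem Finset.sum_range_shift_of_periodic {M : ℕ} {F : ℕ → ℝ} (hF : ∀ j, F (j + M) = F j)
    (m : ℕ) : ∑ j ∈ Finset.range M, F (j + m) = ∑ j ∈ Finset.range M, F j := by
  induction m with
  | zero => simp
  | succ m ih =>
    rw [← ih]
    have h := (Finset.sum_range_succ (fun j => F (j + m)) M).symm.trans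
      (Finset.sum_range_succ' (fun j => F (j + m)) M)
    have hM : F (M + m) = F (0 + m) := by rw [add_comm M, hF, zero_add]
    simp only [add_assoc, add_comm 1 m] at h
    linarith

/-- Three summations by parts of an alternating sum over an even period. -/
theorem alternating_sum_eq_third_difference {N : ℕ} {F : ℕ → ℝ}
    (hF : ∀ j, F (j + 2 * N) = F j) :
    8 * ∑ j ∈ Finset.range (2 * N), (-1) ^ j * F j =
      -∑ j ∈ Finset.range (2 * N),
        (-1) ^ j * (F (j + 3) - 3 * F (j + 2) + 3 * F (j + 1) - F j) := by
  have hG : ∀ j, (-1 : ℝ) ^ (j + 2 * N) * F (j + 2 * N) = (-1) ^ j * F j := by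
    intro j
    rw [hF, pow_add, pow_mul]
    simp
  have s₁ := Finset.sum_range_shift_of_periodic (F := fun j => (-1 : ℝ) ^ j * F j) hG 1
  have s₂ := Finset.sum_range_shift_of_periodic (F := fun j => (-1 : ℝ) ^ j * F j) hG 2
  have s₃ := Finset.sum_range_shift_of_periodic (F := fun j => (-1 : ℝ) ^ j * F j) hG 3
  have split : ∑ j ∈ Finset.range (2 * N),
        (-1 : ℝ) ^ j * (F (j + 3) - 3 * F (j + 2) + 3 * F (j + 1) - F j) =
      -∑ j ∈ Finset.range (2 * N), (-1 : ℝ) ^ (j + 3) * F (j + 3)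
        - 3 * ∑ j ∈ Finset.range (2 * N), (-1 : ℝ) ^ (j + 2) * F (j + 2)
        - 3 * ∑ j ∈ Finset.range (2 * N), (-1 : ℝ) ^ (j + 1) * F (j + 1)
        - ∑ j ∈ Finset.range (2 * N), (-1 : ℝ) ^ j * F j := by
    simp only [Finset.mul_sum, ← Finset.sum_neg_distrib, ← Finset.sum_sub_distrib]
    refine Finset.sum_congr rfl fun j _ => ?_
    ring
  rw [split, s₁, s₂, s₃]
  ring

/-- The absolute value of the dispersion relation of the `π`-flux phase. -/
noncomputable def dispersion (x y : ℝ) : ℝ :=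
  Real.sqrt (1 + Real.cos x / 2 + Real.cos y / 2)

theorem dispersion_comm (x y : ℝ) : dispersion x y = dispersion y x := by
  rw [dispersion, dispersion, add_right_comm]

theorem dispersion_radicand_eq (x y : ℝ) :
    1 + Real.cos x / 2 + Real.cos y / 2 = Real.cos (x / 2) ^ 2 + Real.cos (y / 2) ^ 2 := by
  rw [Real.cos_sq, Real.cos_sq, mul_div_cancel₀ _ two_ne_zero, mul_div_cancel₀ _ two_ne_zero]
  ring

theorem abs_third_difference_dispersion_le {x y h Q : ℝ} (hh : 0 ≤ h) (hQ : 0 < Q)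
    (hpos : ∀ t, 0 < 1 + Real.cos t / 2 + Real.cos y / 2)
    (hle : ∀ t ∈ Set.Icc x (x + 3 * h), Q ≤ 1 + Real.cos t / 2 + Real.cos y / 2) :
    |dispersion (x + 3 * h) y - 3 * dispersion (x + 2 * h) y + 3 * dispersion (x + h) y
      - dispersion x y| ≤ 2 / Q * h ^ 3 := by
  set r : ℝ → ℝ := fun t => dispersion t y with hr
  have r_pos : ∀ t, 0 < r t := fun t => Real.sqrt_pos.2 (hpos t)
  have r_sq : ∀ t, r t ^ 2 = 1 + Real.cos t / 2 + Real.cos y / 2 :=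
    fun t => Real.sq_sqrt (hpos t).le
  have d₁ : ∀ t, HasDerivAt r (-Real.sin t / 2 / (2 * r t)) t := by
    intro t
    have := ((((Real.hasDerivAt_cos t).div_const 2).const_add 1).add_const
      (Real.cos y / 2)).sqrt (hpos t).ne'
    exact this
  have d₂ : ∀ t, HasDerivAt (fun t => -Real.sin t / 2 / (2 * r t))
      (-Real.cos t / 2 / (2 * r t) - (Real.sin t / 2) ^ 2 / (4 * r t ^ 3)) t := by
    intro t
    have := (((Real.hasDerivAt_sin t).neg).div_const 2).div ((d₁ t).const_mul 2)
      (mul_pos two_pos (r_pos t)).ne'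
    refine this.congr_deriv ?_
    have := (r_pos t).ne'
    simp only [Pi.neg_apply]
    field_simp
    ring
  have d₃ : ∀ t, HasDerivAt
      (fun t => -Real.cos t / 2 / (2 * r t) - (Real.sin t / 2) ^ 2 / (4 * r t ^ 3))
      (Real.sin t / 2 / (2 * r t) - 3 * (Real.sin t / 2) * (Real.cos t / 2) / (4 * r t ^ 3)
        - 3 * (Real.sin t / 2) ^ 3 / (8 * r t ^ 5)) t := by
    intro t
    have h0 := (r_pos t).ne'
    have := ((((Real.hasDerivAt_cos t).neg).div_const 2).div ((d₁ t).const_mul 2)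
      (by positivity)).sub ((((Real.hasDerivAt_sin t).div_const 2).pow 2).div
        (((d₁ t).pow 3).const_mul 4) (mul_ne_zero four_ne_zero (pow_ne_zero 3 h0)))
    refine this.congr_deriv ?_
    simp only [Pi.neg_apply, Pi.pow_apply]
    field_simp
    ring
  refine abs_third_difference_le d₁ d₂ d₃ hh fun t ht => ?_
  have hr0 := r_pos t
  have hsin : |Real.sin t / 2| ≤ r t := by
    refine abs_le_of_sq_le_sq ?_ hr0.le
    rw [r_sq]
    nlinarith [Real.sin_sq_add_cos_sq t, Real.neg_one_le_cos t, Real.cos_le_one t,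
      Real.neg_one_le_cos y]
  have hcos : |Real.cos t / 2| ≤ 1 / 2 := by
    rw [abs_div, abs_two]
    linarith [Real.abs_cos_le_one t]
  have hr2 : r t ^ 2 ≤ 2 := by
    rw [r_sq]; linarith [Real.cos_le_one t, Real.cos_le_one y]
  have b₁ : |Real.sin t / 2 / (2 * r t)| ≤ 1 / r t ^ 2 := by
    rw [abs_div, abs_of_pos (by positivity : 0 < 2 * r t), div_le_div_iff₀ (by positivity)
      (by positivity)]
    nlinarith
  have b₂ : |3 * (Real.sin t / 2) * (Real.cos t / 2) / (4 * r t ^ 3)| ≤ 3 / 8 / r t ^ 2 := by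
    rw [abs_div, abs_of_pos (by positivity : 0 < 4 * r t ^ 3), div_le_div_iff₀ (by positivity)
      (by positivity), abs_mul, abs_mul, abs_of_pos (three_pos : (0 : ℝ) < 3)]
    have := mul_le_mul hsin hcos (abs_nonneg _) hr0.le
    nlinarith [mul_le_mul_of_nonneg_right this (sq_nonneg (r t))]
  have b₃ : |3 * (Real.sin t / 2) ^ 3 / (8 * r t ^ 5)| ≤ 3 / 8 / r t ^ 2 := by
    rw [abs_div, abs_of_pos (by positivity : 0 < 8 * r t ^ 5), div_le_div_iff₀ (by positivity)
      (by positivity), abs_mul, abs_pow, abs_of_pos (three_pos : (0 : ℝ) < 3)]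
    have := pow_le_pow_left₀ (abs_nonneg _) hsin 3
    nlinarith [mul_le_mul_of_nonneg_right this (sq_nonneg (r t))]
  calc _ ≤ 1 / r t ^ 2 + 3 / 8 / r t ^ 2 + 3 / 8 / r t ^ 2 :=
        (abs_sub _ _).trans (add_le_add ((abs_sub _ _).trans (add_le_add b₁ b₂)) b₃)
    _ ≤ 2 / r t ^ 2 := by
        rw [← add_div, ← add_div]
        gcongr
        norm_num
    _ ≤ 2 / Q := by
        rw [r_sq]
        have := hle t ht
        gcongr

/-- The alternating sum of the dispersion along a lattice row of the refined momentum lattice. -/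
noncomputable def alternatingRow (N k : ℕ) : ℝ :=
  ∑ j ∈ Finset.range (2 * N),
    (-1) ^ j * dispersion (Real.pi * j / N) (Real.pi * k / N)

/-- The cosine at a lattice momentum is at least the relative distance to the zero at `π`. -/
theorem abs_sub_div_le_abs_cos {N j : ℕ} (hN : 0 < N) (hj : j < 2 * N) :
    |(N : ℝ) - j| / N ≤ |Real.cos (Real.pi * j / N / 2)| := by
  have hN' : (0 : ℝ) < N := by exact_mod_cast hN
  have hj' : (j : ℝ) < 2 * N := by exact_mod_cast hj
  have hpi := Real.pi_pos
  have habs : |((N : ℝ) - j) / N| ≤ 1 := by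
    rw [abs_div, abs_of_pos hN', div_le_one hN', abs_le]
    constructor <;> linarith [(Nat.cast_nonneg j : (0 : ℝ) ≤ j)]
  have hsin := Real.mul_abs_le_abs_sin (x := Real.pi / 2 * (((N : ℝ) - j) / N)) (by
    rw [abs_mul, abs_of_pos (by positivity)]
    exact mul_le_of_le_one_right (by positivity) habs)
  rw [abs_mul, abs_of_pos (by positivity : 0 < Real.pi / 2), abs_div _ (N : ℝ),
    abs_of_pos hN'] at hsin
  rw [← Real.sin_pi_div_two_sub]
  convert hsin using 3
  · field_simp
  · field_simp

theorem third_difference_lattice_le {N j k : ℕ} (hN : 0 < N) (hj : j < 2 * N) (hk : k < 2 * N)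
    (hkN : k ≠ N) :
    |dispersion (Real.pi * (j + 3 : ℕ) / N) (Real.pi * k / N)
      - 3 * dispersion (Real.pi * (j + 2 : ℕ) / N) (Real.pi * k / N)
      + 3 * dispersion (Real.pi * (j + 1 : ℕ) / N) (Real.pi * k / N)
      - dispersion (Real.pi * j / N) (Real.pi * k / N)| ≤
      368 * Real.pi ^ 3 / N * ((|(N : ℝ) - j| + 1)⁻¹ * (|(N : ℝ) - k| + 1)⁻¹) := by
  have hN' : (0 : ℝ) < N := by exact_mod_cast hN
  have hpi := Real.pi_pos
  set u := Real.pi * j / N with hu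
  set y := Real.pi * k / N with hy
  set h := Real.pi / N with hh
  set d := |(N : ℝ) - j| with hd
  set e := |(N : ℝ) - k| with he
  have hd0 : 0 ≤ d := abs_nonneg _
  have he1 : 1 ≤ e := by
    have : (1 : ℤ) ≤ |(N : ℤ) - k| := Int.one_le_abs (by omega)
    rw [he]
    simpa using (Int.cast_le (R := ℝ)).2 this
  have cj : d / N ≤ |Real.cos (u / 2)| := abs_sub_div_le_abs_cos hN hj
  have ck : e / N ≤ |Real.cos (y / 2)| := abs_sub_div_le_abs_cos hN hk
  have cj2 : d ^ 2 / N ^ 2 ≤ Real.cos (u / 2) ^ 2 := by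
    rw [← div_pow, ← sq_abs (Real.cos _)]; gcongr
  have ck2 : e ^ 2 / N ^ 2 ≤ Real.cos (y / 2) ^ 2 := by
    rw [← div_pow, ← sq_abs (Real.cos _)]; gcongr
  have ck1 : 1 / (N : ℝ) ^ 2 ≤ Real.cos (y / 2) ^ 2 := by
    refine le_trans ?_ ck2
    gcongr
    nlinarith
  have ck0 : 0 < Real.cos (y / 2) ^ 2 := lt_of_lt_of_le (by positivity) ck1
  have hlow : (d + 1) * (e + 1) / (4 * N ^ 2) ≤ Real.cos (u / 2) ^ 2 + Real.cos (y / 2) ^ 2 := by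
    refine le_trans ?_ (add_le_add cj2 ck2)
    rw [← add_div, div_le_div_iff₀ (by positivity) (by positivity)]
    have : (d + 1) * (e + 1) ≤ 4 * (d ^ 2 + e ^ 2) := by
      nlinarith [sq_nonneg (d - e), sq_nonneg (d - 1), sq_nonneg (e - 1)]
    nlinarith [mul_le_mul_of_nonneg_right this (sq_nonneg (N : ℝ))]
  have harnack : ∀ t ∈ Set.Icc u (u + 3 * h),
      (d + 1) * (e + 1) / (184 * N ^ 2) ≤ 1 + Real.cos t / 2 + Real.cos y / 2 := by
    intro t ht
    rw [dispersion_radicand_eq]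
    have hlip : |Real.cos (u / 2) - Real.cos (t / 2)| ≤ 3 / 2 * h := by
      refine (Real.abs_cos_sub_cos_le _ _).trans ?_
      rw [abs_le]
      constructor <;> linarith [ht.1, ht.2]
    have hlip2 : (Real.cos (u / 2) - Real.cos (t / 2)) ^ 2 ≤ 22.5 * Real.cos (y / 2) ^ 2 := by
      calc _ = |Real.cos (u / 2) - Real.cos (t / 2)| ^ 2 := (sq_abs _).symm
        _ ≤ (3 / 2 * h) ^ 2 := by gcongr
        _ = (9 / 4 * Real.pi ^ 2) * (1 / (N : ℝ) ^ 2) := by rw [hh]; field_simp; norm_num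
        _ ≤ 22.5 * (1 / (N : ℝ) ^ 2) := by
            gcongr
            nlinarith [Real.pi_lt_d2]
        _ ≤ 22.5 * Real.cos (y / 2) ^ 2 := by gcongr
    have hsplit : (d + 1) * (e + 1) / (184 * N ^ 2) =
        (d + 1) * (e + 1) / (4 * N ^ 2) / 46 := by field_simp; norm_num
    rw [hsplit]
    have : Real.cos (u / 2) ^ 2 ≤ 2 * Real.cos (t / 2) ^ 2 + 45 * Real.cos (y / 2) ^ 2 := by
      nlinarith [sq_nonneg (Real.cos (u / 2) - 2 * Real.cos (t / 2))]
    rw [div_le_iff₀ (by norm_num)]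
    nlinarith [sq_nonneg (Real.cos (t / 2))]
  have hpos : ∀ t, 0 < 1 + Real.cos t / 2 + Real.cos y / 2 := fun t => by
    rw [dispersion_radicand_eq]; positivity
  have key := abs_third_difference_dispersion_le (x := u) (h := h) (by positivity)
    (by positivity) hpos harnack
  have e₁ : Real.pi * (j + 1 : ℕ) / N = u + h := by push_cast; rw [hu, hh]; ring
  have e₂ : Real.pi * (j + 2 : ℕ) / N = u + 2 * h := by push_cast; rw [hu, hh]; ring
  have e₃ : Real.pi * (j + 3 : ℕ) / N = u + 3 * h := by push_cast; rw [hu, hh]; ring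
  rw [e₁, e₂, e₃]
  refine key.trans_eq ?_
  rw [hh]
  field_simp
  norm_num

theorem abs_alternatingRow_le {N k : ℕ} (hN : 0 < N) (hk : k < 2 * N) (hkN : k ≠ N) :
    |alternatingRow N k| ≤ 46 * Real.pi ^ 3 / N *
      (∑ j ∈ Finset.range (2 * N), (|(N : ℝ) - j| + 1)⁻¹) * (|(N : ℝ) - k| + 1)⁻¹ := by
  have hN' : (N : ℝ) ≠ 0 := by exact_mod_cast hN.ne'
  have hper : ∀ j : ℕ, dispersion (Real.pi * (j + 2 * N : ℕ) / N) (Real.pi * k / N) =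
      dispersion (Real.pi * j / N) (Real.pi * k / N) := by
    intro j
    have : Real.pi * (j + 2 * N : ℕ) / N = Real.pi * j / N + 2 * Real.pi := by
      push_cast; field_simp
    rw [this, dispersion, dispersion, Real.cos_add_two_pi]
  have h8 := alternating_sum_eq_third_difference
    (F := fun j => dispersion (Real.pi * j / N) (Real.pi * k / N)) hper
  have : |8 * alternatingRow N k| ≤ ∑ j ∈ Finset.range (2 * N),
      368 * Real.pi ^ 3 / N * ((|(N : ℝ) - j| + 1)⁻¹ * (|(N : ℝ) - k| + 1)⁻¹) := by
    rw [alternatingRow, h8, abs_neg]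
    refine (Finset.abs_sum_le_sum_abs _ _).trans (Finset.sum_le_sum fun j hj => ?_)
    rw [abs_mul, abs_pow, abs_neg, abs_one, one_pow, one_mul]
    exact third_difference_lattice_le hN (Finset.mem_range.1 hj) hk hkN
  rw [← Finset.mul_sum, ← Finset.sum_mul, abs_mul, abs_of_pos (by norm_num : (0 : ℝ) < 8)] at this
  linear_combination this / 8

theorem alternating_sum_sin {M : ℕ} (θ : ℝ) :
    2 * Real.cos (θ / 2) * ∑ j ∈ Finset.range M, (-1) ^ j * Real.sin (j * θ) =
      -Real.sin (θ / 2) - (-1) ^ M * Real.sin (M * θ - θ / 2) := by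
  induction M with
  | zero => simp
  | succ M ih =>
    rw [Finset.sum_range_succ, mul_add, ih, Real.sin_sub, Nat.cast_succ,
      show ((M : ℝ) + 1) * θ - θ / 2 = M * θ + θ / 2 by ring, Real.sin_add]
    ring

theorem abs_alternatingRow_self_le {N : ℕ} (hN : 0 < N) :
    |alternatingRow N N| ≤ Real.pi / N := by
  have hN' : (0 : ℝ) < N := by exact_mod_cast hN
  have hN1 : (1 : ℝ) ≤ N := by exact_mod_cast hN
  have hpi := Real.pi_pos
  set θ := Real.pi / (2 * N) with hθ
  have hθ0 : 0 < θ := by positivity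
  have hθN : N * θ = Real.pi / 2 := by rw [hθ]; field_simp
  have hθ1 : θ ≤ Real.pi / 2 := by nlinarith
  have hdisp : ∀ j : ℕ, dispersion (Real.pi * j / N) (Real.pi * N / N) = |Real.cos (j * θ)| := by
    intro j
    rw [dispersion, dispersion_radicand_eq, mul_div_cancel_right₀ _ hN'.ne', Real.cos_pi_div_two,
      zero_pow two_ne_zero, add_zero, Real.sqrt_sq_eq_abs]
    congr 2
    rw [hθ]; field_simp
  have hper : ∀ j : ℕ, (-1 : ℝ) ^ (j + 2 * N) * |Real.cos ((j + 2 * N : ℕ) * θ)| =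
      (-1) ^ j * |Real.cos (j * θ)| := by
    intro j
    have : ((j + 2 * N : ℕ) : ℝ) * θ = j * θ + Real.pi := by push_cast; linarith
    rw [this, Real.cos_add_pi, abs_neg, pow_add, pow_mul]
    simp
  have hrow : alternatingRow N N = (-1) ^ N * ∑ j ∈ Finset.range (2 * N),
      (-1) ^ j * Real.sin (j * θ) := by
    simp only [alternatingRow, hdisp]
    rw [← Finset.sum_range_shift_of_periodic hper N, Finset.mul_sum]
    refine Finset.sum_congr rfl fun j hj => ?_
    have hj' : (j : ℝ) ≤ 2 * N := by exact_mod_cast (Finset.mem_range.1 hj).le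
    have hsin : 0 ≤ Real.sin (j * θ) := Real.sin_nonneg_of_nonneg_of_le_pi (by positivity)
      (by nlinarith)
    rw [Nat.cast_add, add_mul, hθN, Real.cos_add_pi_div_two, abs_neg, abs_of_nonneg hsin]
    ring
  have hsum := alternating_sum_sin (M := 2 * N) θ
  rw [pow_mul, neg_one_sq, one_pow, one_mul,
    show ((2 * N : ℕ) : ℝ) * θ - θ / 2 = Real.pi - θ / 2 by push_cast; linarith,
    Real.sin_pi_sub] at hsum
  have hcos : 1 / 2 ≤ Real.cos (θ / 2) := by
    rw [← Real.cos_pi_div_three]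
    exact Real.cos_le_cos_of_nonneg_of_le_pi (by positivity) (by linarith) (by linarith)
  rw [hrow, abs_mul, abs_pow, abs_neg, abs_one, one_pow, one_mul]
  set S := ∑ j ∈ Finset.range (2 * N), (-1 : ℝ) ^ j * Real.sin (j * θ)
  have hS : 2 * Real.cos (θ / 2) * |S| = 2 * |Real.sin (θ / 2)| := by
    rw [← abs_of_pos (by linarith : 0 < 2 * Real.cos (θ / 2)), ← abs_mul, hsum,
      show -Real.sin (θ / 2) - Real.sin (θ / 2) = -(2 * Real.sin (θ / 2)) by ring, abs_neg,
      abs_mul, abs_two]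
  have hsin := Real.abs_sin_le_abs (x := θ / 2)
  rw [abs_of_pos (by positivity : 0 < θ / 2)] at hsin
  have : Real.pi / N = 2 * θ := by rw [hθ]; field_simp
  nlinarith [abs_nonneg S]

theorem sum_inv_abs_sub_add_one_le (N : ℕ) :
    ∑ j ∈ Finset.range (2 * N), (|(N : ℝ) - j| + 1)⁻¹ ≤ 2 * (1 + Real.log N) := by
  have hH : ∑ i ∈ Finset.range N, ((i : ℝ) + 1)⁻¹ ≤ 1 + Real.log N := by
    have := harmonic_le_one_add_log N
    simpa [harmonic] using this
  rw [two_mul, Finset.sum_range_add, two_mul]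
  refine add_le_add (le_trans ?_ hH) (le_trans (le_of_eq ?_) hH)
  · rw [← Finset.sum_range_reflect]
    refine Finset.sum_le_sum fun j hj => ?_
    have hj' : 1 + j ≤ N := by have := Finset.mem_range.1 hj; omega
    have hcast : (N : ℝ) - (N - 1 - j : ℕ) = j + 1 := by
      rw [Nat.sub_sub, Nat.cast_sub hj']; push_cast; ring
    rw [hcast, abs_of_nonneg (by positivity)]
    gcongr
    linarith
  · refine Finset.sum_congr rfl fun j _ => ?_
    rw [Nat.cast_add, sub_add_cancel_left, abs_neg, abs_of_nonneg (by positivity)]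

theorem sum_abs_alternatingRow_le {N : ℕ} (hN : 0 < N) :
    ∑ k ∈ Finset.range (2 * N), |alternatingRow N k| ≤
      (Real.pi + 184 * Real.pi ^ 3) * (1 + Real.log N) ^ 2 / N := by
  have hN' : (0 : ℝ) < N := by exact_mod_cast hN
  have hpi := Real.pi_pos
  have hlog : 0 ≤ Real.log N := Real.log_natCast_nonneg N
  set W := ∑ j ∈ Finset.range (2 * N), (|(N : ℝ) - j| + 1)⁻¹ with hW
  have hW0 : 0 ≤ W := Finset.sum_nonneg fun j _ => by positivity
  have hWle : W ≤ 2 * (1 + Real.log N) := sum_inv_abs_sub_add_one_le N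
  have hrow : ∀ k ∈ Finset.range (2 * N), |alternatingRow N k| ≤
      (if k = N then Real.pi / N else 0) +
        46 * Real.pi ^ 3 / N * W * (|(N : ℝ) - k| + 1)⁻¹ := by
    intro k hk
    split_ifs with h
    · subst h
      exact (abs_alternatingRow_self_le hN).trans (le_add_of_nonneg_right (by positivity))
    · rw [zero_add]
      exact abs_alternatingRow_le hN (Finset.mem_range.1 hk) h
  calc _ ≤ _ := Finset.sum_le_sum hrow
    _ = Real.pi / N + 46 * Real.pi ^ 3 / N * W * W := by
        rw [Finset.sum_add_distrib, ← Finset.mul_sum, ← hW, Finset.sum_ite_eq',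
          if_pos (Finset.mem_range.2 (by omega))]
    _ ≤ Real.pi * (1 + Real.log N) ^ 2 / N +
          46 * Real.pi ^ 3 / N * (2 * (1 + Real.log N)) * (2 * (1 + Real.log N)) := by
        gcongr
        exact le_mul_of_one_le_right hpi.le (one_le_pow₀ (le_add_of_nonneg_right hlog))
    _ = _ := by ring

/-- The lattice sum of the dispersion over momenta of prescribed parity in the refined lattice. -/
noncomputable def latticeSum (N p q : ℕ) : ℝ :=
  ∑ i ∈ Finset.range N, ∑ j ∈ Finset.range N,
    dispersion (Real.pi * (2 * i + p : ℕ) / N) (Real.pi * (2 * j + q : ℕ) / N)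

theorem latticeSum_comm (N p q : ℕ) : latticeSum N p q = latticeSum N q p := by
  rw [latticeSum, latticeSum, Finset.sum_comm]
  simp only [dispersion_comm]

theorem Finset.sum_range_two_mul_eq (N : ℕ) (F : ℕ → ℝ) :
    ∑ k ∈ Finset.range (2 * N), F k =
      ∑ i ∈ Finset.range N, F (2 * i) + ∑ i ∈ Finset.range N, F (2 * i + 1) := by
  induction N with
  | zero => simp
  | succ N ih =>
    rw [mul_add, mul_one, Finset.sum_range_succ, Finset.sum_range_succ, ih,
      Finset.sum_range_succ, Finset.sum_range_succ]
    ring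

theorem abs_latticeSum_sub_le (N : ℕ) {q : ℕ} (hq : q = 0 ∨ q = 1) :
    |latticeSum N 0 q - latticeSum N 1 q| ≤
      ∑ k ∈ Finset.range (2 * N), |alternatingRow N k| := by
  have hdiff : latticeSum N 0 q - latticeSum N 1 q =
      ∑ j ∈ Finset.range N, alternatingRow N (2 * j + q) := by
    rw [latticeSum, latticeSum, Finset.sum_comm, Finset.sum_comm (s := Finset.range N)
      (f := fun i j => dispersion (Real.pi * (2 * i + 1 : ℕ) / N) _), ← Finset.sum_sub_distrib]
    refine Finset.sum_congr rfl fun j _ => ?_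
    rw [alternatingRow, Finset.sum_range_two_mul_eq]
    simp [pow_add, pow_mul, sub_eq_add_neg]
  have he : 0 ≤ ∑ i ∈ Finset.range N, |alternatingRow N (2 * i)| :=
    Finset.sum_nonneg fun _ _ => abs_nonneg _
  have ho : 0 ≤ ∑ i ∈ Finset.range N, |alternatingRow N (2 * i + 1)| :=
    Finset.sum_nonneg fun _ _ => abs_nonneg _
  rw [hdiff, Finset.sum_range_two_mul_eq]
  refine (Finset.abs_sum_le_sum_abs _ _).trans ?_
  rcases hq with rfl | rfl
  · simpa using ho
  · simpa using he

theorem abs_latticeSum_sub_one_one_le (N : ℕ) {p q : ℕ} (hp : p = 0 ∨ p = 1)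
    (hq : q = 0 ∨ q = 1) :
    |latticeSum N p q - latticeSum N 1 1| ≤
      2 * ∑ k ∈ Finset.range (2 * N), |alternatingRow N k| := by
  set B := ∑ k ∈ Finset.range (2 * N), |alternatingRow N k|
  have hB : 0 ≤ B := Finset.sum_nonneg fun _ _ => abs_nonneg _
  have h₁ : |latticeSum N p q - latticeSum N 1 q| ≤ B := by
    rcases hp with rfl | rfl
    · exact abs_latticeSum_sub_le N hq
    · simpa using hB
  have h₂ : |latticeSum N 1 q - latticeSum N 1 1| ≤ B := by
    rw [latticeSum_comm N 1 q]
    rcases hq with rfl | rfl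
    · exact abs_latticeSum_sub_le N (Or.inr rfl)
    · simpa using hB
  linarith [abs_sub_le (latticeSum N p q) (latticeSum N 1 q) (latticeSum N 1 1)]

theorem one_add_log_sq_div_le {ε : ℝ} (hε : 0 < ε) {n : ℕ} (hn : 1 ≤ n) :
    (1 + Real.log (2 * n + 1 : ℕ)) ^ 2 / (2 * n + 1 : ℕ) ≤
      ((1 + 1 / ε) * 3 ^ ε) ^ 2 * (n : ℝ) ^ (2 * ε - 1) := by
  have hn1 : (1 : ℝ) ≤ n := by exact_mod_cast hn
  have hn0 : (0 : ℝ) < n := by linarith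
  have hN : ((2 * n + 1 : ℕ) : ℝ) = 2 * n + 1 := by push_cast; ring
  rw [hN]
  have hpow : (2 * (n : ℝ) + 1) ^ ε ≤ 3 ^ ε * (n : ℝ) ^ ε := by
    rw [← Real.mul_rpow (by norm_num) hn0.le]
    exact Real.rpow_le_rpow (by positivity) (by linarith) hε.le
  have hone : 1 ≤ (2 * (n : ℝ) + 1) ^ ε := Real.one_le_rpow (by linarith) hε.le
  have hlog : 1 + Real.log (2 * n + 1) ≤ (1 + 1 / ε) * 3 ^ ε * (n : ℝ) ^ ε := by
    calc _ ≤ (2 * (n : ℝ) + 1) ^ ε + (2 * (n : ℝ) + 1) ^ ε / ε :=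
          add_le_add hone (Real.log_le_rpow_div (by positivity) hε)
      _ = (1 + 1 / ε) * (2 * (n : ℝ) + 1) ^ ε := by ring
      _ ≤ _ := by rw [mul_assoc]; gcongr
  have hlog0 : 0 ≤ 1 + Real.log (2 * (n : ℝ) + 1) := by
    linarith [Real.log_nonneg (by linarith : (1 : ℝ) ≤ 2 * n + 1)]
  calc _ ≤ ((1 + 1 / ε) * 3 ^ ε * (n : ℝ) ^ ε) ^ 2 / n := by gcongr; linarith
    _ = _ := by
        rw [Real.rpow_sub_one hn0.ne', mul_comm 2 ε, Real.rpow_mul hn0.le, Real.rpow_two]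
        ring

/-- **Near-degeneracy of the π-flux ground state energies (`L = 2(2n+1)` case).**
With `f(x,y) = −√(1 + cos x / 2 + cos y / 2)`, the difference between the lattice
sums of the dispersion with fluxes `(a,b)` and with fluxes `(−1,−1)` on the
non-contractible loops is bounded by `C_α · n^{3α−1}` for any `0 < α < 1/3`. -/
theorem pi_flux_energy_difference_odd (α : ℝ) (hα₀ : 0 < α) (hα : α < 1 / 3) :
    ∃ C : ℝ, 0 < C ∧
      ∀ n : ℕ, 1 ≤ n → ∀ a b : ℝ, (a = 1 ∨ a = -1) → (b = 1 ∨ b = -1) →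
        |∑ n₁ ∈ Finset.range (2 * n + 1), ∑ n₂ ∈ Finset.range (2 * n + 1),
            ((-Real.sqrt (1 +
                Real.cos (Real.pi * (2 * (n₁ : ℝ) + 1) / (2 * n + 1)
                  - Real.pi * (a + 1) / (2 * (2 * n + 1))) / 2 +
                Real.cos (Real.pi * (2 * (n₂ : ℝ) + 1) / (2 * n + 1)
                  - Real.pi * (b + 1) / (2 * (2 * n + 1))) / 2)) -
             (-Real.sqrt (1 +
                Real.cos (Real.pi * (2 * (n₁ : ℝ) + 1) / (2 * n + 1)) / 2 +
                Real.cos (Real.pi * (2 * (n₂ : ℝ) + 1) / (2 * n + 1)) / 2)))| ≤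
          C * (n : ℝ) ^ (3 * α - 1) := by
  set K := 2 * (Real.pi + 184 * Real.pi ^ 3) * ((1 + 1 / (3 * α / 2)) * 3 ^ (3 * α / 2)) ^ 2
    with hK
  have hpi := Real.pi_pos
  refine ⟨K, by positivity, fun n hn a b ha hb => ?_⟩
  have angle : ∀ c : ℝ, (c = 1 ∨ c = -1) → ∃ p : ℕ, (p = 0 ∨ p = 1) ∧ ∀ i : ℕ,
      Real.pi * (2 * (i : ℝ) + 1) / (2 * n + 1) - Real.pi * (c + 1) / (2 * (2 * n + 1)) =
        Real.pi * (2 * i + p : ℕ) / (2 * n + 1 : ℕ) := by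
    rintro c (rfl | rfl)
    · refine ⟨0, Or.inl rfl, fun i => ?_⟩
      push_cast; field_simp; ring
    · refine ⟨1, Or.inr rfl, fun i => ?_⟩
      push_cast; field_simp; ring
  obtain ⟨p, hp, hpa⟩ := angle a ha
  obtain ⟨q, hq, hqb⟩ := angle b hb
  have hbase : ∀ i : ℕ, Real.pi * (2 * (i : ℝ) + 1) / (2 * n + 1) =
      Real.pi * (2 * i + 1 : ℕ) / (2 * n + 1 : ℕ) := fun i => by push_cast; rfl
  simp only [hpa, hqb]
  simp only [hbase]
  have hsum := abs_latticeSum_sub_one_one_le (2 * n + 1) hp hq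
  rw [← abs_neg] at hsum
  simp only [latticeSum, dispersion, ← Finset.sum_sub_distrib, ← Finset.sum_neg_distrib] at hsum
  simp only [neg_sub_neg]
  simp only [neg_sub] at hsum
  refine hsum.trans ?_
  have hrows := sum_abs_alternatingRow_le (N := 2 * n + 1) (by omega)
  have hlog := one_add_log_sq_div_le (ε := 3 * α / 2) (by positivity) hn
  rw [mul_div_cancel₀ _ two_ne_zero] at hlog
  calc _ ≤ 2 * ((Real.pi + 184 * Real.pi ^ 3) *
        ((1 + Real.log (2 * n + 1 : ℕ)) ^ 2 / (2 * n + 1 : ℕ))) := by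
        rw [← mul_div_assoc]; gcongr
    _ ≤ 2 * ((Real.pi + 184 * Real.pi ^ 3) *
        (((1 + 1 / (3 * α / 2)) * 3 ^ (3 * α / 2)) ^ 2 * (n : ℝ) ^ (3 * α - 1))) := by gcongr
    _ = _ := by rw [hK]; ring
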